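/- arXiv:2501.06955 — 3 statements merged into one kernel-verified Lean document; each statement's English description precedes it below -/
import Mathlib

section
/- Let n ≥ 1 and let X be an object of D(𝒜) concentrated in [-n+1, 0], and let m be an integer with 0 ≤ m ≤ n-1. Then the following are equivalent: (i) H^i(X) = 0 for all i ≤ -m; (ii) Hom_{D(𝒜)}(Z, X⟦i⟧) = 0 for every object Z of D(𝒜) concentrated in [-n+1, 0] and every integer i ≤ -m. -/
open CategoryTheory CategoryTheory.Limits CategoryTheory.Pretriangulated

universe w v u

variable {𝒜 : Type u} [Category.{v} 𝒜] [Abelian 𝒜] [HasDerivedCategory.{w} 𝒜]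

/-- An object of the derived category is concentrated in degrees `[-n+1, 0]` if its
homology vanishes in degrees `< -n+1` and `> 0`. -/
def Concentrated (n : ℤ) (X : DerivedCategory 𝒜) : Prop :=
  ∀ i : ℤ, (i < -n + 1 ∨ 0 < i) → IsZero ((DerivedCategory.homologyFunctor 𝒜 i).obj X)

/-- Membership in `[-n+1, 0]` in terms of the canonical t-structure. -/
lemma concentrated_iff (n : ℤ) (X : DerivedCategory 𝒜) :
    Concentrated n X ↔ X.IsGE (-n + 1) ∧ X.IsLE 0 := by
  rw [DerivedCategory.isGE_iff, DerivedCategory.isLE_iff]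
  exact ⟨fun h ↦ ⟨fun i hi ↦ h i (Or.inl hi), fun i hi ↦ h i (Or.inr hi)⟩,
    fun h i hi ↦ hi.elim (h.1 i) (h.2 i)⟩

theorem stmt_1 (n : ℤ) (hn : 1 ≤ n) (X : DerivedCategory 𝒜) (hX : Concentrated n X)
    (m : ℤ) (hm0 : 0 ≤ m) (hm1 : m ≤ n - 1) :
    (∀ i : ℤ, i ≤ -m → IsZero ((DerivedCategory.homologyFunctor 𝒜 i).obj X)) ↔
    (∀ (Z : DerivedCategory 𝒜), Concentrated n Z →
      ∀ i : ℤ, i ≤ -m → ∀ (g : Z ⟶ X⟦i⟧), g = 0) := by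
  have hGE : (∀ i : ℤ, i ≤ -m → IsZero ((DerivedCategory.homologyFunctor 𝒜 i).obj X)) ↔
      X.IsGE (-m + 1) := by
    rw [DerivedCategory.isGE_iff]
    exact forall_congr' fun i ↦ by rw [Int.lt_add_one_iff]
  rw [hGE]
  constructor
  · intro _ Z hZ i hi g
    have := ((concentrated_iff n Z).1 hZ).2
    have := DerivedCategory.TStructure.t.isGE_shift X (-m + 1) i (-m + 1 - i)
    exact DerivedCategory.TStructure.t.zero g 0 (-m + 1 - i)
  · intro h
    have := ((concentrated_iff n X).1 hX).1
    obtain ⟨A, B, hA, hB, f, p, δ, hT⟩ :=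
      DerivedCategory.TStructure.t.exists_triangle X (-m) (-m + 1) rfl
    have : A.IsLE (-m) := ⟨hA⟩
    have : B.IsGE (-m + 1) := ⟨hB⟩
    have hA' : A.IsGE (-n + 1) := by
      have := DerivedCategory.TStructure.t.isGE_shift B (-m + 1) (-1) (-m + 2)
      exact DerivedCategory.TStructure.t.isGE₂ _ (inv_rot_of_distTriang _ hT) (-n + 1)
        (DerivedCategory.TStructure.t.isGE_of_ge (B⟦(-1 : ℤ)⟧) _ (-m + 2)) ‹_›
    have hZ : Concentrated n (A⟦-m⟧) := by
      have := DerivedCategory.TStructure.t.isGE_shift A (-n + 1) (-m) (-n + 1 + m)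
      exact (concentrated_iff n _).2
        ⟨DerivedCategory.TStructure.t.isGE_of_ge _ _ (-n + 1 + m),
          DerivedCategory.TStructure.t.isLE_shift A (-m) (-m) 0⟩
    have hf : f = 0 := (shiftFunctor (DerivedCategory 𝒜) (-m)).map_injective (by
      rw [Functor.map_zero]
      exact h _ hZ (-m) le_rfl _)
    rw [DerivedCategory.IsGE, DerivedCategory.TStructure.t.isGE_iff_orthogonal (-m) (-m + 1) rfl]
    intro Y g _
    obtain ⟨g', hg'⟩ : ∃ g' : Y ⟶ A, g = g' ≫ f := Triangle.coyoneda_exact₂ _ hT g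
      (DerivedCategory.TStructure.t.zero (g ≫ p) (-m) (-m + 1))
    rw [hg', hf, comp_zero]
end

section
/- Let n ≥ 1, let X and Y be objects of D(𝒜) concentrated in [-n+1, 0], and let f : X → Y be a morphism. Suppose f = m ∘ e with e : X → Z, m : Z → Y and f = m' ∘ e' with e' : X → Z', m' : Z' → Y are two [1,n]-factorizations of f. Then there exists a unique morphism t : Z → Z' satisfying t ∘ e = e' and m' ∘ t = m, and this t is an isomorphism in D(𝒜). (Uniqueness of [1,n]-factorizations.) -/
open CategoryTheory CategoryTheory.Limits CategoryTheory.Pretriangulated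

universe w v u

variable {𝒜 : Type u} [Category.{v} 𝒜] [Abelian 𝒜] [HasDerivedCategory.{w} 𝒜]

/-- `e`, `m` form a `[1,n]`-factorization of `f`. -/
def IsOneNFactorization (n : ℤ) {X Y Z : DerivedCategory 𝒜}
    (f : X ⟶ Y) (e : X ⟶ Z) (m : Z ⟶ Y) : Prop :=
  Concentrated n Z ∧ e ≫ m = f ∧
    Mono ((DerivedCategory.homologyFunctor 𝒜 (-n + 1)).map m) ∧
    Epi ((DerivedCategory.homologyFunctor 𝒜 (-n + 1)).map e) ∧
    ∀ i : ℤ, -n + 2 ≤ i → IsIso ((DerivedCategory.homologyFunctor 𝒜 i).map e)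

open DerivedCategory in
/-- A morphism between objects concentrated in a single degree `a` is detected by `H^a`. -/
lemma eq_zero_of_isLE_of_isGE_of_homologyMap_eq_zero {K W : DerivedCategory 𝒜} (a : ℤ)
    [K.IsLE a] [K.IsGE a] [W.IsLE a] [W.IsGE a] (g : K ⟶ W)
    (hg : (homologyFunctor 𝒜 a).map g = 0) : g = 0 := by
  obtain ⟨A, ⟨α⟩⟩ := exists_iso_singleFunctor_obj_of_isGE_of_isLE K a
  obtain ⟨B, ⟨β⟩⟩ := exists_iso_singleFunctor_obj_of_isGE_of_isLE W a
  obtain ⟨φ, hφ⟩ := (singleFunctor 𝒜 a).map_surjective (α.inv ≫ g ≫ β.hom)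
  have hφ₀ : φ = 0 := by
    rw [← Functor.id_map φ, ← NatIso.naturality_1 (singleFunctorCompHomologyFunctorIso 𝒜 a) φ,
      Functor.comp_map, hφ]
    simp [hg]
  rw [← cancel_epi α.inv, ← cancel_mono β.hom, Category.assoc, ← hφ, hφ₀]
  simp

open DerivedCategory in
lemma mono_homologyMap_of_distTriang_of_isZero {K X Z : DerivedCategory 𝒜} {k : K ⟶ X}
    {e : X ⟶ Z} {d : Z ⟶ K⟦(1 : ℤ)⟧} (hT : Triangle.mk k e d ∈ distTriang _)
    (i j : ℤ) (hij : i + 1 = j) (h : IsZero ((homologyFunctor 𝒜 i).obj Z)) :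
    Mono ((homologyFunctor 𝒜 j).map k) :=
  (HomologySequence.mono_homologyMap_mor₁_iff _ hT i j hij).2 (h.eq_of_src _ _)

open DerivedCategory in
/-- If `K` is concentrated in degree `a` and `W` in degrees `≥ a`, morphisms `K ⟶ W` are
detected by `H^a`. -/
lemma eq_zero_of_isGE_of_homologyMap_eq_zero {K W : DerivedCategory 𝒜} (a : ℤ)
    [K.IsLE a] [K.IsGE a] [W.IsGE a] (g : K ⟶ W)
    (hg : (homologyFunctor 𝒜 a).map g = 0) : g = 0 := by
  obtain ⟨A, B, hA, hB, i, p, d, hT⟩ := TStructure.t.exists_triangle W a (a + 1) rfl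
  have : A.IsLE a := ⟨hA⟩
  have : B.IsGE (a + 1) := ⟨hB⟩
  have hi (j : ℤ) (hj : j ≤ a) : Mono ((homologyFunctor 𝒜 j).map i) :=
    mono_homologyMap_of_distTriang_of_isZero hT (j - 1) j (by lia)
      (B.isZero_of_isGE (a + 1) (j - 1) (by lia))
  have : A.IsGE a := (isGE_iff A a).2 fun j hj ↦
    have := hi j hj.le
    (W.isZero_of_isGE a j hj).of_mono ((homologyFunctor 𝒜 j).map i)
  have hgp : g ≫ p = 0 :=
    TStructure.t.zero_of_isLE_of_isGE _ a (a + 1) (by lia) inferInstance inferInstance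
  obtain ⟨g' : K ⟶ A, rfl : g = g' ≫ i⟩ := Triangle.coyoneda_exact₂ _ hT g hgp
  have := hi a le_rfl
  have hg' : g' = 0 := eq_zero_of_isLE_of_isGE_of_homologyMap_eq_zero a g' (by
    rw [← cancel_mono ((homologyFunctor 𝒜 a).map i), ← Functor.map_comp, zero_comp,
      hg])
  rw [hg', zero_comp]

lemma Concentrated.isGE {n : ℤ} {X : DerivedCategory 𝒜} (hX : Concentrated n X) :
    X.IsGE (-n + 1) :=
  (DerivedCategory.isGE_iff X _).2 fun i hi ↦ hX i (Or.inl hi)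

open DerivedCategory in
/-- The fiber of a morphism inducing an epimorphism on `H^a` and isomorphisms on `H^i` for `i > a`,
between objects in degrees `≥ a`, is concentrated in degree `a`. -/
lemma isLE_and_isGE_fiber_of_distTriang {K X Z : DerivedCategory 𝒜} {k : K ⟶ X}
    {e : X ⟶ Z} {d : Z ⟶ K⟦(1 : ℤ)⟧} (hT : Triangle.mk k e d ∈ distTriang _)
    (a : ℤ) [X.IsGE a] [Z.IsGE a]
    (hepi : Epi ((homologyFunctor 𝒜 a).map e))
    (hiso : ∀ i : ℤ, a < i → IsIso ((homologyFunctor 𝒜 i).map e)) :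
    K.IsLE a ∧ K.IsGE a := by
  refine ⟨(isLE_iff _ _).2 fun i hi ↦ ?_, (isGE_iff _ _).2 fun i hi ↦ ?_⟩
  · have hepi' : Epi ((homologyFunctor 𝒜 (i - 1)).map e) := by
      obtain rfl | h := (Int.le_sub_one_of_lt hi).eq_or_lt
      · exact hepi
      · have := hiso _ h
        infer_instance
    have := hiso i hi
    have hmono : Mono ((homologyFunctor 𝒜 i).map k) :=
      (HomologySequence.mono_homologyMap_mor₁_iff _ hT (i - 1) i (by lia)).2
        ((HomologySequence.epi_homologyMap_mor₂_iff _ hT (i - 1) i (by lia)).1 hepi')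
    have hk : (homologyFunctor 𝒜 i).map k = 0 :=
      (HomologySequence.mono_homologyMap_mor₂_iff _ hT i).1
        (inferInstanceAs (Mono ((homologyFunctor 𝒜 i).map e)))
    exact IsZero.of_mono_eq_zero _ hk
  · have := mono_homologyMap_of_distTriang_of_isZero hT (i - 1) i (by lia)
      (Z.isZero_of_isGE a (i - 1) (by lia))
    exact (X.isZero_of_isGE a i hi).of_mono ((homologyFunctor 𝒜 i).map k)

open DerivedCategory in
/-- A morphism `e` whose fiber is in degrees `≤ a` is left cancellable against objects in
degrees `≥ a`. -/
lemma eq_of_comp_eq_of_distTriang {K X Z : DerivedCategory 𝒜} {k : K ⟶ X}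
    {e : X ⟶ Z} {d : Z ⟶ K⟦(1 : ℤ)⟧} (hT : Triangle.mk k e d ∈ distTriang _)
    (a : ℤ) [K.IsLE a] {W : DerivedCategory 𝒜} [W.IsGE a] (s t : Z ⟶ W)
    (h : e ≫ s = e ≫ t) : s = t := by
  have hst : e ≫ (s - t) = 0 := by rw [Preadditive.comp_sub, h, sub_self]
  obtain ⟨r : K⟦(1 : ℤ)⟧ ⟶ W, hr : s - t = d ≫ r⟩ := Triangle.yoneda_exact₃ _ hT (s - t) hst
  have := TStructure.t.isLE_shift K a 1 (a - 1)
  rw [← sub_eq_zero, hr,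
    TStructure.t.zero_of_isLE_of_isGE r (a - 1) a (by lia) inferInstance inferInstance, comp_zero]

/-- A comparison morphism between two `[1,n]`-factorizations is an isomorphism. -/
lemma IsOneNFactorization.isIso {n : ℤ} {X Y Z Z' : DerivedCategory 𝒜} {f : X ⟶ Y}
    {e : X ⟶ Z} {m : Z ⟶ Y} {e' : X ⟶ Z'} {m' : Z' ⟶ Y}
    (h₁ : IsOneNFactorization n f e m) (h₂ : IsOneNFactorization n f e' m')
    (t : Z ⟶ Z') (he : e ≫ t = e') (hm : t ≫ m' = m) : IsIso t := by
  obtain ⟨hZ, -, hm₁, -, hiso⟩ := h₁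
  obtain ⟨hZ', -, -, hepi', hiso'⟩ := h₂
  subst he hm
  simp only [Functor.map_comp] at hm₁ hepi' hiso'
  refine (DerivedCategory.isIso_iff 𝒜 t).2 fun i ↦ ?_
  obtain hi | rfl | hi := lt_trichotomy i (-n + 1)
  · exact isIso_of_source_target_iso_zero _
      (hZ i (Or.inl hi)).isoZero (hZ' i (Or.inl hi)).isoZero
  · have := mono_of_mono ((DerivedCategory.homologyFunctor 𝒜 (-n + 1)).map t)
      ((DerivedCategory.homologyFunctor 𝒜 (-n + 1)).map m')
    have := epi_of_epi ((DerivedCategory.homologyFunctor 𝒜 (-n + 1)).map e)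
      ((DerivedCategory.homologyFunctor 𝒜 (-n + 1)).map t)
    exact isIso_of_mono_of_epi _
  · have := hiso i (by lia)
    have := hiso' i (by lia)
    exact IsIso.of_isIso_comp_left ((DerivedCategory.homologyFunctor 𝒜 i).map e) _

theorem stmt_8 (n : ℤ) (hn : 1 ≤ n) (X Y Z Z' : DerivedCategory 𝒜)
    (hX : Concentrated n X) (hY : Concentrated n Y) (f : X ⟶ Y)
    (e : X ⟶ Z) (m : Z ⟶ Y) (e' : X ⟶ Z') (m' : Z' ⟶ Y)
    (h₁ : IsOneNFactorization n f e m) (h₂ : IsOneNFactorization n f e' m') :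
    (∃! t : Z ⟶ Z', e ≫ t = e' ∧ t ≫ m' = m) ∧
      ∀ t : Z ⟶ Z', e ≫ t = e' → t ≫ m' = m → IsIso t := by
  refine ⟨?_, h₁.isIso h₂⟩
  obtain ⟨hZ, rfl, -, hepi, hiso⟩ := h₁
  obtain ⟨hZ', hf', hmono', -, -⟩ := h₂
  have := hX.isGE
  have := hY.isGE
  have := hZ.isGE
  have := hZ'.isGE
  obtain ⟨K, k, d, hT⟩ := distinguished_cocone_triangle₁ e
  obtain ⟨(_ : K.IsLE _), (_ : K.IsGE _)⟩ := isLE_and_isGE_fiber_of_distTriang hT (-n + 1) hepi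
    fun i hi ↦ hiso i (by lia)
  have hke : k ≫ e = 0 := comp_distTriang_mor_zero₁₂ _ hT
  have hke' : k ≫ e' = 0 := by
    apply eq_zero_of_isGE_of_homologyMap_eq_zero (-n + 1)
    rw [← cancel_mono ((DerivedCategory.homologyFunctor 𝒜 (-n + 1)).map m'), ← Functor.map_comp,
      Category.assoc, hf', reassoc_of% hke, zero_comp, Functor.map_zero, zero_comp]
  obtain ⟨t : Z ⟶ Z', ht : e' = e ≫ t⟩ := Triangle.yoneda_exact₂ _ hT e' hke'
  refine ⟨t, ⟨ht.symm, ?_⟩, fun s hs ↦ ?_⟩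
  · apply eq_of_comp_eq_of_distTriang hT (-n + 1)
    rw [← hf', ht, Category.assoc]
  · exact eq_of_comp_eq_of_distTriang hT (-n + 1) _ _ (hs.1.trans ht)
end

section
/- Let n ≥ 1, let X and Y be objects of D(𝒜) concentrated in [-n+1, 0], and let f : X → Y be any morphism. Then there exist an object Z of D(𝒜) concentrated in [-n+1, 0] and morphisms e : X → Z and m : Z → Y with f = m ∘ e such that: H^0(e) is an epimorphism in 𝒜, H^0(m) is a monomorphism in 𝒜, and H^i(m) is an isomorphism in 𝒜 for all i ≤ -1. Moreover, if f = m' ∘ e' with e' : X → Z', m' : Z' → Y is another such factorization, then there exists an isomorphism t : Z → Z' with t ∘ e = e' and m' ∘ t = m. (Existence and uniqueness of the [n,1]-factorization.) -/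
open CategoryTheory CategoryTheory.Limits CategoryTheory.Pretriangulated

universe w v u

variable {𝒜 : Type u} [Category.{v} 𝒜] [Abelian 𝒜] [HasDerivedCategory.{w} 𝒜]

namespace DerivedCategory

open HomologySequence

/-- In a distinguished triangle, `H^i` of the third object vanishes as soon as the first morphism
is an epimorphism on `H^i` and a monomorphism on `H^{i+1}`. -/
lemma isZero_homology_obj₃ {T : Triangle (DerivedCategory 𝒜)} (hT : T ∈ distTriang _)
    (i j : ℤ) (hij : i + 1 = j) (h₁ : Epi ((homologyFunctor 𝒜 i).map T.mor₁))
    (h₂ : Mono ((homologyFunctor 𝒜 j).map T.mor₁)) :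
    IsZero ((homologyFunctor 𝒜 i).obj T.obj₃) :=
  (exact₃ T hT i j hij).isZero_X₂ ((epi_homologyMap_mor₁_iff T hT i).1 h₁)
    ((mono_homologyMap_mor₁_iff T hT i j hij).1 h₂)

lemma epi_homologyMap_mor₁ {T : Triangle (DerivedCategory 𝒜)} (hT : T ∈ distTriang _)
    (i : ℤ) (h : IsZero ((homologyFunctor 𝒜 i).obj T.obj₃)) :
    Epi ((homologyFunctor 𝒜 i).map T.mor₁) :=
  (epi_homologyMap_mor₁_iff T hT i).2 (h.eq_of_tgt _ _)

lemma mono_homologyMap_mor₁ {T : Triangle (DerivedCategory 𝒜)} (hT : T ∈ distTriang _)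
    (i j : ℤ) (hij : i + 1 = j) (h : IsZero ((homologyFunctor 𝒜 i).obj T.obj₃)) :
    Mono ((homologyFunctor 𝒜 j).map T.mor₁) :=
  (mono_homologyMap_mor₁_iff T hT i j hij).2 (h.eq_of_src _ _)

lemma epi_homologyMap_mor₂ {T : Triangle (DerivedCategory 𝒜)} (hT : T ∈ distTriang _)
    (i j : ℤ) (hij : i + 1 = j) (h : IsZero ((homologyFunctor 𝒜 j).obj T.obj₁)) :
    Epi ((homologyFunctor 𝒜 i).map T.mor₂) :=
  (epi_homologyMap_mor₂_iff T hT i j hij).2 (h.eq_of_tgt _ _)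

/-- The cone of a `1`-monomorphism is `≥ 0`. -/
lemma isGE_obj₃_of_one_mono {T : Triangle (DerivedCategory 𝒜)} (hT : T ∈ distTriang _)
    (h₀ : Mono ((homologyFunctor 𝒜 0).map T.mor₁))
    (h : ∀ i : ℤ, i ≤ -1 → IsIso ((homologyFunctor 𝒜 i).map T.mor₁)) :
    T.obj₃.IsGE 0 := by
  rw [isGE_iff]
  intro i hi
  have := h i (by lia)
  refine isZero_homology_obj₃ hT i (i + 1) rfl inferInstance ?_
  obtain hi' | rfl : i + 1 ≤ -1 ∨ i = -1 := by lia
  · have := h _ hi'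
    infer_instance
  · simpa using h₀

/-- The cone of an `n`-epimorphism between objects that are `≤ 0` is `≤ -1`. -/
lemma isLE_obj₃_of_epi {T : Triangle (DerivedCategory 𝒜)} (hT : T ∈ distTriang _)
    (_ : T.obj₁.IsLE 0) (_ : T.obj₂.IsLE 0) (h₀ : Epi ((homologyFunctor 𝒜 0).map T.mor₁)) :
    T.obj₃.IsLE (-1) := by
  rw [isLE_iff]
  intro i hi
  refine isZero_homology_obj₃ hT i (i + 1) rfl ?_
    ⟨fun _ _ _ ↦ (isZero_of_isLE T.obj₁ 0 (i + 1) (by lia)).eq_of_tgt _ _⟩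
  obtain rfl | hi' : i = 0 ∨ 0 < i := by lia
  · exact h₀
  · exact ⟨fun _ _ _ ↦ (isZero_of_isLE T.obj₂ 0 i hi').eq_of_src _ _⟩

/-- Morphisms from an object that is `≤ 0` can be cancelled against a `1`-monomorphism. -/
lemma hom_ext_of_one_mono {X Z Y : DerivedCategory 𝒜} [X.IsLE 0] (m : Z ⟶ Y)
    (h₀ : Mono ((homologyFunctor 𝒜 0).map m))
    (h : ∀ i : ℤ, i ≤ -1 → IsIso ((homologyFunctor 𝒜 i).map m))
    {a b : X ⟶ Z} (hab : a ≫ m = b ≫ m) : a = b := by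
  obtain ⟨W, p, q, hT⟩ := distinguished_cocone_triangle m
  have : W.IsGE 0 := isGE_obj₃_of_one_mono hT h₀ h
  have : (W⟦(-1 : ℤ)⟧).IsGE 1 := TStructure.t.isGE_shift W 0 (-1) 1
  obtain ⟨c, hc⟩ := Triangle.coyoneda_exact₂ _ (inv_rot_of_distTriang _ hT) (a - b)
    (show (a - b) ≫ m = 0 by rw [Preadditive.sub_comp, hab, sub_self])
  have hc₀ : c = 0 := TStructure.t.zero_of_isLE_of_isGE c 0 1 (by lia) inferInstance this
  rw [← sub_eq_zero, hc, hc₀]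
  exact zero_comp

/-- `n`-epimorphisms have the left lifting property with respect to `1`-monomorphisms. -/
lemma exists_lift_of_epi_of_one_mono {X Z Z' Y : DerivedCategory 𝒜} [X.IsLE 0] [Z.IsLE 0]
    {e : X ⟶ Z} {m : Z ⟶ Y} {e' : X ⟶ Z'} {m' : Z' ⟶ Y} (fac : e ≫ m = e' ≫ m')
    (he : Epi ((homologyFunctor 𝒜 0).map e)) (h₀ : Mono ((homologyFunctor 𝒜 0).map m'))
    (h : ∀ i : ℤ, i ≤ -1 → IsIso ((homologyFunctor 𝒜 i).map m')) :
    ∃ t : Z ⟶ Z', e ≫ t = e' ∧ t ≫ m' = m := by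
  obtain ⟨V, r, s, hV⟩ := distinguished_cocone_triangle e
  obtain ⟨W, p, q, hW⟩ := distinguished_cocone_triangle m'
  have : W.IsGE 0 := isGE_obj₃_of_one_mono hW h₀ h
  have : V.IsLE (-1) := isLE_obj₃_of_epi hV ‹X.IsLE 0› ‹Z.IsLE 0› he
  have hm'p : m' ≫ p = 0 := comp_distTriang_mor_zero₁₂ _ hW
  obtain ⟨c, hc⟩ : ∃ c : V ⟶ W, m ≫ p = r ≫ c := Triangle.yoneda_exact₂ _ hV (m ≫ p)
    (show e ≫ m ≫ p = 0 by rw [reassoc_of% fac, hm'p, comp_zero])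
  have hc₀ : c = 0 := TStructure.t.zero_of_isLE_of_isGE c (-1) 0 (by lia) ‹_› ‹_›
  obtain ⟨t, ht⟩ : ∃ t : Z ⟶ Z', m = t ≫ m' := Triangle.coyoneda_exact₂ _ hW m
    (show m ≫ p = 0 by rw [hc, hc₀, comp_zero])
  exact ⟨t, hom_ext_of_one_mono m' h₀ h (by rw [Category.assoc, ← ht, fac]), ht.symm⟩

lemma exists_epi_one_mono_factorization {X Y : DerivedCategory 𝒜} [X.IsLE 0] [Y.IsLE 0]
    (f : X ⟶ Y) :
    ∃ (Z : DerivedCategory 𝒜) (e : X ⟶ Z) (m : Z ⟶ Y),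
      Z.IsLE 0 ∧ e ≫ m = f ∧ Epi ((homologyFunctor 𝒜 0).map e) ∧
      Mono ((homologyFunctor 𝒜 0).map m) ∧
      ∀ i : ℤ, i ≤ -1 → IsIso ((homologyFunctor 𝒜 i).map m) := by
  obtain ⟨W, g, δ, hW⟩ := distinguished_cocone_triangle f
  obtain ⟨L, T, hL, hT, ι, π, δ', hLT⟩ :=
    TStructure.t.exists_triangle W (-1) 0 (by lia)
  have : L.IsLE (-1) := ⟨hL⟩
  have : T.IsGE 0 := ⟨hT⟩
  obtain ⟨Z, m, δ'', hZ⟩ := distinguished_cocone_triangle₁ (g ≫ π)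
  have hfg : f ≫ g = 0 := comp_distTriang_mor_zero₁₂ _ hW
  have hmg : m ≫ g ≫ π = 0 := comp_distTriang_mor_zero₁₂ _ hZ
  obtain ⟨e, he⟩ : ∃ e : X ⟶ Z, f = e ≫ m := Triangle.coyoneda_exact₂ _ hZ f
    (show f ≫ g ≫ π = 0 by rw [reassoc_of% hfg, zero_comp])
  have fac : e ≫ m = f := he.symm
  have hm₀ : Mono ((homologyFunctor 𝒜 0).map m) :=
    mono_homologyMap_mor₁ hZ (-1) 0 (by lia) (isZero_of_isGE T 0 (-1) (by lia))
  have hπ : Mono ((homologyFunctor 𝒜 0).map π) :=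
    (mono_homologyMap_mor₂_iff _ hLT 0).2
      ((isZero_of_isLE L (-1) 0 (by lia)).eq_of_src _ _)
  refine ⟨Z, e, m, ?_, fac, ?_, hm₀, fun i hi ↦ ?_⟩
  · rw [isLE_iff]
    intro i hi
    have : Epi ((homologyFunctor 𝒜 (i - 1)).map g) :=
      epi_homologyMap_mor₂ hW (i - 1) i (by lia) (isZero_of_isLE X 0 i hi)
    have : Epi ((homologyFunctor 𝒜 (i - 1)).map π) :=
      epi_homologyMap_mor₂ hLT (i - 1) i (by lia) (isZero_of_isLE L (-1) i (by lia))
    have hgπ : Epi ((homologyFunctor 𝒜 (i - 1)).map (g ≫ π)) := by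
      rw [Functor.map_comp]
      infer_instance
    have hm : Mono ((homologyFunctor 𝒜 i).map m) :=
      (mono_homologyMap_mor₁_iff _ hZ (i - 1) i (by lia)).2
        ((epi_homologyMap_mor₂_iff _ hZ (i - 1) i (by lia)).1 hgπ)
    exact (isZero_of_isLE Y 0 i hi).of_mono ((homologyFunctor 𝒜 i).map m)
  · rw [epi_iff_surjective_up_to_refinements]
    intro A a
    have hmg₀ : (homologyFunctor 𝒜 0).map m ≫ (homologyFunctor 𝒜 0).map g = 0 := by
      rw [← cancel_mono ((homologyFunctor 𝒜 0).map π), Category.assoc, ← Functor.map_comp,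
        ← Functor.map_comp, hmg, Functor.map_zero, zero_comp]
    obtain ⟨A', ρ, hρ, x, hx⟩ : ∃ (A' : 𝒜) (ρ : A' ⟶ A) (_ : Epi ρ)
        (x : A' ⟶ (homologyFunctor 𝒜 0).obj X),
        ρ ≫ a ≫ (homologyFunctor 𝒜 0).map m = x ≫ (homologyFunctor 𝒜 0).map f :=
      (exact₂ _ hW 0).exact_up_to_refinements (a ≫ (homologyFunctor 𝒜 0).map m)
        (show (a ≫ (homologyFunctor 𝒜 0).map m) ≫ (homologyFunctor 𝒜 0).map g = 0 by
          rw [Category.assoc, hmg₀, comp_zero])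
    refine ⟨A', ρ, hρ, x, ?_⟩
    rw [← cancel_mono ((homologyFunctor 𝒜 0).map m), Category.assoc, Category.assoc,
      ← Functor.map_comp, fac, hx]
  · have : Mono ((homologyFunctor 𝒜 i).map m) :=
      mono_homologyMap_mor₁ hZ (i - 1) i (by lia) (isZero_of_isGE T 0 (i - 1) (by lia))
    have : Epi ((homologyFunctor 𝒜 i).map m) :=
      epi_homologyMap_mor₁ hZ i (isZero_of_isGE T 0 i (by lia))
    exact isIso_of_mono_of_epi _

end DerivedCategory

lemma Concentrated.isLE {n : ℤ} {X : DerivedCategory 𝒜} (hX : Concentrated n X) : X.IsLE 0 :=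
  (DerivedCategory.isLE_iff X 0).2 fun i hi ↦ hX i (Or.inr hi)

theorem stmt_9 (n : ℤ) (hn : 1 ≤ n) (X Y : DerivedCategory 𝒜)
    (hX : Concentrated n X) (hY : Concentrated n Y) (f : X ⟶ Y) :
    (∃ (Z : DerivedCategory 𝒜) (e : X ⟶ Z) (m : Z ⟶ Y),
      Concentrated n Z ∧ e ≫ m = f ∧
      Epi ((DerivedCategory.homologyFunctor 𝒜 0).map e) ∧
      Mono ((DerivedCategory.homologyFunctor 𝒜 0).map m) ∧
      ∀ i : ℤ, i ≤ -1 → IsIso ((DerivedCategory.homologyFunctor 𝒜 i).map m)) ∧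
    (∀ (Z Z' : DerivedCategory 𝒜) (e : X ⟶ Z) (m : Z ⟶ Y) (e' : X ⟶ Z') (m' : Z' ⟶ Y),
      (Concentrated n Z ∧ e ≫ m = f ∧
        Epi ((DerivedCategory.homologyFunctor 𝒜 0).map e) ∧
        Mono ((DerivedCategory.homologyFunctor 𝒜 0).map m) ∧
        ∀ i : ℤ, i ≤ -1 → IsIso ((DerivedCategory.homologyFunctor 𝒜 i).map m)) →
      (Concentrated n Z' ∧ e' ≫ m' = f ∧
        Epi ((DerivedCategory.homologyFunctor 𝒜 0).map e') ∧
        Mono ((DerivedCategory.homologyFunctor 𝒜 0).map m') ∧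
        ∀ i : ℤ, i ≤ -1 → IsIso ((DerivedCategory.homologyFunctor 𝒜 i).map m')) →
      ∃ t : Z ⟶ Z', IsIso t ∧ e ≫ t = e' ∧ t ≫ m' = m) := by
  have := hX.isLE
  have := hY.isLE
  refine ⟨?_, ?_⟩
  · obtain ⟨Z, e, m, hZ, fac, he, hm₀, hm⟩ :=
      DerivedCategory.exists_epi_one_mono_factorization f
    refine ⟨Z, e, m, ?_, fac, he, hm₀, hm⟩
    rintro i (hi | hi)
    · have := hm i (by lia)
      exact (hY i (Or.inl hi)).of_iso (asIso ((DerivedCategory.homologyFunctor 𝒜 i).map m))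
    · exact Z.isZero_of_isLE 0 i hi
  · rintro Z Z' e m e' m' ⟨hZ, fac, he, hm₀, hm⟩ ⟨hZ', fac', he', hm₀', hm'⟩
    have := hZ.isLE
    have := hZ'.isLE
    obtain ⟨t, het, htm⟩ :=
      DerivedCategory.exists_lift_of_epi_of_one_mono (fac.trans fac'.symm) he hm₀' hm'
    obtain ⟨s, -, hsm⟩ :=
      DerivedCategory.exists_lift_of_epi_of_one_mono (fac'.trans fac.symm) he' hm₀ hm
    refine ⟨t, ⟨s, ?_, ?_⟩, het, htm⟩
    · exact DerivedCategory.hom_ext_of_one_mono m hm₀ hm (by simp [hsm, htm])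
    · exact DerivedCategory.hom_ext_of_one_mono m' hm₀' hm' (by simp [hsm, htm])
end
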